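/- arXiv:1201.0418 — 9 statements merged into one kernel-verified Lean document; each statement's English description precedes it below -/
import Mathlib

section
/- For every ρ ∈ [0,1]: if α > 1 then B_α(ρ) ≤ 1 − ρ, and if α < 0 then 1 − ρ ≤ B_α(ρ); that is, BBD with α > 1 lies below the squared Hellinger distance H²(ρ) = 1 − ρ, and BBD with α < 0 lies above it. -/
/-- The bounded Bhattacharyya distance (BBD) as a function of the
Bhattacharyya coefficient `ρ`, with parameter `α`. -/
noncomputable def BBD (α ρ : ℝ) : ℝ :=
  Real.log (1 - (1 - ρ) / α) / Real.log (1 - 1 / α)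

/-- The chord from `1` to `1 - x` lies below the graph of the logarithm. -/
theorem mul_log_one_sub_le_log_one_sub_mul {x t : ℝ} (hx : x < 1) (ht : t ∈ Set.Icc (0 : ℝ) 1) :
    t * Real.log (1 - x) ≤ Real.log (1 - t * x) := by
  have h := strictConcaveOn_log_Ioi.concaveOn.2 (Set.mem_Ioi.2 one_pos)
    (Set.mem_Ioi.2 (sub_pos.2 hx)) (sub_nonneg.2 ht.2) ht.1 (sub_add_cancel 1 t)
  simp only [smul_eq_mul, Real.log_one, mul_zero, zero_add] at h
  rwa [show (1 - t) * 1 + t * (1 - x) = 1 - t * x by ring] at h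

theorem bbd_vs_squared_hellinger (α ρ : ℝ) (hρ : ρ ∈ Set.Icc (0 : ℝ) 1) :
    (1 < α → BBD α ρ ≤ 1 - ρ) ∧ (α < 0 → 1 - ρ ≤ BBD α ρ) := by
  have ht : 1 - ρ ∈ Set.Icc (0 : ℝ) 1 := ⟨sub_nonneg.2 hρ.2, sub_le_self 1 hρ.1⟩
  unfold BBD
  rw [div_eq_mul_one_div (1 - ρ) α]
  constructor
  · intro hα
    have h0 : 0 < 1 / α := by positivity
    have h1 : 1 / α < 1 := (div_lt_one (by linarith)).2 hα
    rw [div_le_iff_of_neg (Real.log_neg (by linarith) (by linarith))]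
    exact mul_log_one_sub_le_log_one_sub_mul h1 ht
  · intro hα
    have h0 : 1 / α < 0 := one_div_neg.2 hα
    rw [le_div_iff₀ (Real.log_pos (by linarith))]
    exact mul_log_one_sub_le_log_one_sub_mul (by linarith) ht
end

section
/- Let λ be a measure and p₁,…,pₙ probability densities with respect to λ, and let β₁,…,βₙ ≥ 0 with ∑ᵢ βᵢ = 1. Then the generalized Bhattacharyya coefficient ρ_β = ∫ ∏ᵢ pᵢ^{βᵢ} dλ satisfies 0 ≤ ρ_β ≤ 1, and consequently the generalized BBD measure B_α^β = log(1 − (1−ρ_β)/α)/log(1 − 1/α) satisfies 0 ≤ B_α^β ≤ 1 for every α with α < 0 or α > 1. -/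
open MeasureTheory

/-- The integral of a weighted geometric mean of densities is at most one. -/
theorem integral_prod_rpow_le_one {Ω ι : Type*} [MeasurableSpace Ω] [Fintype ι] (μ : Measure Ω)
    (p : ι → Ω → ℝ) (β : ι → ℝ) (hp0 : ∀ i x, 0 ≤ p i x) (hp1 : ∀ i, ∫ x, p i x ∂μ = 1)
    (hβ0 : ∀ i, 0 ≤ β i) (hβ1 : ∑ i, β i = 1) :
    ∫ x, ∏ i, (p i x) ^ (β i) ∂μ ≤ 1 := by
  have hint (i : ι) : Integrable (p i) μ := by
    by_contra h
    simpa [integral_undef h] using hp1 i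
  calc ∫ x, ∏ i, (p i x) ^ (β i) ∂μ
      ≤ ∫ x, ∑ i, β i * p i x ∂μ := by
        refine integral_mono_of_nonneg
          (.of_forall fun x => Finset.prod_nonneg fun i _ => Real.rpow_nonneg (hp0 i x) _)
          (integrable_finsetSum _ fun i _ => (hint i).const_mul _)
          (.of_forall fun x => ?_)
        exact Real.geom_mean_le_arith_mean_weighted _ _ _ (fun i _ => hβ0 i) hβ1
          fun i _ => hp0 i x
    _ = 1 := by
        rw [integral_finsetSum _ fun i _ => (hint i).const_mul _]
        simp [integral_const_mul, hp1, hβ1]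

/-- The bounded Bhattacharyya transform maps the unit interval to itself. -/
theorem log_div_log_mem_Icc {α r : ℝ} (hα : α < 0 ∨ 1 < α) (hr0 : 0 ≤ r) (hr1 : r ≤ 1) :
    Real.log (1 - (1 - r) / α) / Real.log (1 - 1 / α) ∈ Set.Icc 0 1 := by
  rcases hα with hα | hα
  · have h1 : (1 - r) / α ≤ 0 := div_nonpos_of_nonneg_of_nonpos (by linarith) hα.le
    have h2 : 1 / α ≤ (1 - r) / α := div_le_div_of_nonpos_of_le hα.le (by linarith)
    have ha : 0 ≤ Real.log (1 - (1 - r) / α) := Real.log_nonneg (by linarith)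
    have hab : Real.log (1 - (1 - r) / α) ≤ Real.log (1 - 1 / α) :=
      Real.log_le_log (by linarith) (by linarith)
    exact ⟨div_nonneg ha (ha.trans hab), div_le_one_of_le₀ hab (ha.trans hab)⟩
  · have hα0 : 0 < α := by linarith
    have h1 : 0 ≤ (1 - r) / α := div_nonneg (by linarith) hα0.le
    have h2 : (1 - r) / α ≤ 1 / α := by gcongr; linarith
    have h3 : 1 / α < 1 := (div_lt_one hα0).2 hα
    have ha : Real.log (1 - (1 - r) / α) ≤ 0 := Real.log_nonpos (by linarith) (by linarith)
    have hab : Real.log (1 - 1 / α) ≤ Real.log (1 - (1 - r) / α) :=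
      Real.log_le_log (by linarith) (by linarith)
    exact ⟨div_nonneg_of_nonpos ha (hab.trans ha), div_le_one_of_ge hab (hab.trans ha)⟩

theorem generalized_bbd_bounded
    {Ω : Type*} [MeasurableSpace Ω] (μ : Measure Ω) (n : ℕ)
    (p : Fin n → Ω → ℝ) (β : Fin n → ℝ)
    (hpm : ∀ i, Measurable (p i)) (hp0 : ∀ i x, 0 ≤ p i x)
    (hp1 : ∀ i, ∫ x, p i x ∂μ = 1)
    (hβ0 : ∀ i, 0 ≤ β i) (hβ1 : ∑ i, β i = 1)
    (α : ℝ) (hα : α < 0 ∨ 1 < α) :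
    -- the generalized Bhattacharyya coefficient lies in [0,1]
    (0 ≤ ∫ x, ∏ i, (p i x) ^ (β i) ∂μ) ∧ (∫ x, ∏ i, (p i x) ^ (β i) ∂μ ≤ 1) ∧
    -- consequently the generalized BBD measure lies in [0,1]
    (0 ≤ Real.log (1 - (1 - ∫ x, ∏ i, (p i x) ^ (β i) ∂μ) / α) /
        Real.log (1 - 1 / α)) ∧
    (Real.log (1 - (1 - ∫ x, ∏ i, (p i x) ^ (β i) ∂μ) / α) /
        Real.log (1 - 1 / α) ≤ 1) := by
  have h0 : 0 ≤ ∫ x, ∏ i, (p i x) ^ (β i) ∂μ :=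
    integral_nonneg fun x => Finset.prod_nonneg fun i _ => Real.rpow_nonneg (hp0 i x) _
  have h1 := integral_prod_rpow_le_one μ p β hp0 hp1 hβ0 hβ1
  exact ⟨h0, h1, log_div_log_mem_Icc hα h0 h1⟩
end

section
/- Fix α > 1 and let p, q be probability densities with respect to a measure λ with q > 0 λ-almost everywhere. Define f(x) = −1 + (1 − √x)/α for x ≥ 0 and g(F) = log(−F)/log(1 − 1/α). Then f is convex on [0,∞), g is increasing on its domain, ∫ f(p/q)·q dλ = −1 + (1 − ρ)/α where ρ = ∫√(pq) dλ, and g(∫ f(p/q)·q dλ) = B_α(P,Q); hence B_α is an f-divergence with respect to the pair (f, g). -/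
open MeasureTheory

theorem bbd_is_f_divergence
    {Ω : Type*} [MeasurableSpace Ω] (μ : Measure Ω) (p q : Ω → ℝ)
    (hpm : Measurable p) (hqm : Measurable q)
    (hp0 : ∀ x, 0 ≤ p x) (hq0 : ∀ x, 0 ≤ q x)
    (hp1 : ∫ x, p x ∂μ = 1) (hq1 : ∫ x, q x ∂μ = 1)
    (hqpos : ∀ᵐ x ∂μ, 0 < q x)
    (hint : Integrable (fun x => Real.sqrt (p x * q x)) μ)
    (α : ℝ) (hα : 1 < α) :
    -- `f` is convex on `[0, ∞)`
    ConvexOn ℝ (Set.Ici (0 : ℝ)) (fun x : ℝ => -1 + (1 - Real.sqrt x) / α) ∧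
    -- `g` is increasing on its domain `(-∞, 0)` (where `-F > 0`)
    StrictMonoOn (fun F : ℝ => Real.log (-F) / Real.log (1 - 1 / α))
      (Set.Iio (0 : ℝ)) ∧
    -- the inner Csiszar integral evaluates to `-1 + (1 - ρ)/α`
    (∫ x, (-1 + (1 - Real.sqrt (p x / q x)) / α) * q x ∂μ =
      -1 + (1 - ∫ x, Real.sqrt (p x * q x) ∂μ) / α) ∧
    -- applying `g` yields the BBD measure `B_α(P,Q)`
    (Real.log (-(-1 + (1 - ∫ x, Real.sqrt (p x * q x) ∂μ) / α)) /
        Real.log (1 - 1 / α) =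
      Real.log (1 - (1 - ∫ x, Real.sqrt (p x * q x) ∂μ) / α) /
        Real.log (1 - 1 / α)) := by
  have hα0 : 0 < α := one_pos.trans hα
  have hlog : Real.log (1 - 1 / α) < 0 := by
    have h1 : 1 / α < 1 := (div_lt_one hα0).2 hα
    have h2 : 0 < 1 / α := by positivity
    exact Real.log_neg (by linarith) (by linarith)
  refine ⟨⟨convex_Ici 0, fun x hx y hy a b ha hb hab => ?_⟩, fun x hx y hy hxy => ?_, ?_, ?_⟩
  · have h := Real.strictConcaveOn_sqrt.concaveOn.2 hx hy ha hb hab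
    simp only [smul_eq_mul] at h ⊢
    calc -1 + (1 - √(a * x + b * y)) / α
        ≤ -1 + (1 - (a * √x + b * √y)) / α := by gcongr
      _ = a * (-1 + (1 - √x) / α) + b * (-1 + (1 - √y) / α) := by
        obtain rfl : b = 1 - a := by linarith
        ring
  · have hy' : 0 < -y := neg_pos.2 hy
    exact div_lt_div_of_neg_of_lt hlog (Real.log_lt_log hy' (neg_lt_neg hxy))
  · have hq : Integrable q μ := by
      by_contra h
      simp [integral_undef h] at hq1
    have hae : (fun x => (-1 + (1 - √(p x / q x)) / α) * q x) =ᵐ[μ]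
        fun x => (-1 + 1 / α) * q x - 1 / α * √(p x * q x) := by
      filter_upwards [hqpos] with x hx
      have h : √(p x / q x) * q x = √(p x * q x) := by
        rw [Real.sqrt_div (hp0 x), Real.sqrt_mul (hp0 x), div_mul_eq_mul_div, mul_div_assoc,
          Real.div_sqrt]
      rw [← h]
      ring
    rw [integral_congr_ae hae, integral_sub (hq.const_mul _) (hint.const_mul _),
      integral_const_mul, integral_const_mul, hq1]
    ring
  · congr 2
    ring
end

section
/- Let p₁^β, p₂^β and p₁^{β'}, p₂^{β'} be two pairs of probability densities with respect to a measure λ, with Bhattacharyya coefficients ρ(β) = ∫√(p₁^β p₂^β) dλ and ρ(β') = ∫√(p₁^{β'} p₂^{β'}) dλ. If ρ(β) < ρ(β') (equivalently B_α(ρ(β)) > B_α(ρ(β')) for any admissible α), then there exist prior probabilities π₁, π₂ ≥ 0 with π₁ + π₂ = 1 such that the Bayes error probabilities satisfy P_e(β, Γ) < P_e(β', Γ), where P_e(ω, Γ) = ∫ min(π₁ p₁^ω, π₂ p₂^ω) dλ. -/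
open MeasureTheory

/-- The geometric mean as a superposition of weighted minima. -/
theorem lintegral_min_mul_rpow_neg_two {a b : ℝ} (ha : 0 ≤ a) (hb : 0 ≤ b) :
    ∫⁻ s in Set.Ioi (0 : ℝ), ENNReal.ofReal (min a (b * s ^ (-2 : ℝ))) =
      ENNReal.ofReal (2 * √(a * b)) := by
  rcases ha.eq_or_lt with rfl | ha'
  · have h : Set.EqOn (fun s : ℝ => ENNReal.ofReal (min 0 (b * s ^ (-2 : ℝ)))) 0
        (Set.Ioi 0) := by
      intro s _
      simp
    rw [setLIntegral_eq_zero measurableSet_Ioi h]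
    simp
  rcases hb.eq_or_lt with rfl | hb'
  · simp [min_eq_right ha]
  set c : ℝ := √(b / a) with hc
  have hc0 : 0 < c := Real.sqrt_pos.2 (div_pos hb' ha')
  have hc2 : a * c ^ 2 = b := by
    rw [hc, Real.sq_sqrt (div_pos hb' ha').le]
    field_simp
  have hac : √(a * b) = a * c := by
    rw [← hc2, show a * (a * c ^ 2) = (a * c) ^ 2 by ring]
    exact Real.sqrt_sq (by positivity)
  have hrpow : ∀ s : ℝ, 0 < s → s ^ (-2 : ℝ) = (s ^ 2)⁻¹ := by
    intro s hs
    rw [Real.rpow_neg hs.le, Real.rpow_two]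
  have hleft : Set.EqOn (fun s : ℝ => ENNReal.ofReal (min a (b * s ^ (-2 : ℝ))))
      (fun _ => ENNReal.ofReal a) (Set.Ioc 0 c) := by
    intro s hs
    have h : a ≤ b * s ^ (-2 : ℝ) := by
      rw [hrpow s hs.1, ← div_eq_mul_inv, le_div_iff₀ (pow_pos hs.1 2), ← hc2]
      have := pow_le_pow_left₀ hs.1.le hs.2 2
      gcongr
    simp only [min_eq_left h]
  have hright : Set.EqOn (fun s : ℝ => ENNReal.ofReal (min a (b * s ^ (-2 : ℝ))))
      (fun s => ENNReal.ofReal (b * s ^ (-2 : ℝ))) (Set.Ioi c) := by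
    intro s hs
    have hs0 : 0 < s := hc0.trans hs
    have h : b * s ^ (-2 : ℝ) ≤ a := by
      rw [hrpow s hs0, ← div_eq_mul_inv, div_le_iff₀ (pow_pos hs0 2), ← hc2]
      have := pow_le_pow_left₀ hc0.le (le_of_lt hs) 2
      gcongr
    simp only [min_eq_right h]
  have htail : ∫ s in Set.Ioi c, b * s ^ (-2 : ℝ) = a * c := by
    rw [integral_const_mul, integral_Ioi_rpow_of_lt (by norm_num) hc0,
      show (-2 : ℝ) + 1 = -1 by norm_num, Real.rpow_neg_one, ← hc2]
    field_simp
  rw [← Set.Ioc_union_Ioi_eq_Ioi hc0.le,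
    lintegral_union measurableSet_Ioi Set.Ioc_disjoint_Ioi_same,
    setLIntegral_congr_fun measurableSet_Ioc hleft,
    setLIntegral_congr_fun measurableSet_Ioi hright, setLIntegral_const,
    ← ofReal_integral_eq_lintegral_ofReal
      ((integrableOn_Ioi_rpow_of_lt (by norm_num) hc0).const_mul b), htail, hac,
    Real.volume_Ioc, sub_zero, ← ENNReal.ofReal_mul ha,
    ← ENNReal.ofReal_add (by positivity) (by positivity), two_mul]
  filter_upwards [ae_restrict_mem measurableSet_Ioi] with s hs
  have : 0 < s := hc0.trans hs
  positivity

section Densities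

variable {Ω : Type*} [MeasurableSpace Ω] {μ : Measure Ω} {p q : Ω → ℝ}

theorem integrable_sqrt_mul (hpm : Measurable p) (hqm : Measurable q)
    (hp : Integrable p μ) (hq : Integrable q μ) (hp0 : ∀ x, 0 ≤ p x) (hq0 : ∀ x, 0 ≤ q x) :
    Integrable (fun x => √(p x * q x)) μ := by
  refine (hp.add hq).mono' (hpm.mul hqm).sqrt.aestronglyMeasurable (ae_of_all _ fun x => ?_)
  have h₁ := hp0 x
  have h₂ := hq0 x
  rw [Real.norm_of_nonneg (Real.sqrt_nonneg _)]
  refine Real.sqrt_le_iff.2 ⟨add_nonneg h₁ h₂, ?_⟩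
  simp only [Pi.add_apply]
  nlinarith [mul_nonneg h₁ h₂]

/-- The Bhattacharyya coefficient as a superposition of (unnormalised) Bayes errors. -/
theorem ofReal_two_mul_integral_sqrt_mul_eq_lintegral (hpm : Measurable p) (hqm : Measurable q)
    (hp : Integrable p μ) (hq : Integrable q μ) (hp0 : ∀ x, 0 ≤ p x) (hq0 : ∀ x, 0 ≤ q x) :
    ENNReal.ofReal (2 * ∫ x, √(p x * q x) ∂μ) =
      ∫⁻ s in Set.Ioi (0 : ℝ), ENNReal.ofReal (∫ x, min (p x) (q x * s ^ (-2 : ℝ)) ∂μ) := by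
  obtain ⟨t, -, htp, hσ⟩ :=
    ((memLp_one_iff_integrable.2 hp).finStronglyMeasurable_of_stronglyMeasurable
      hpm.stronglyMeasurable one_ne_zero ENNReal.one_ne_top).exists_set_sigmaFinite
  have hsupp : Function.support (fun x => ENNReal.ofReal (2 * √(p x * q x))) ⊆ t := by
    intro x hx
    by_contra hxt
    exact hx (by simp [htp x hxt])
  have hmeas : Measurable (Function.uncurry fun (x : Ω) (s : ℝ) =>
      ENNReal.ofReal (min (p x) (q x * s ^ (-2 : ℝ)))) := by
    unfold Function.uncurry
    fun_prop
  rw [← integral_const_mul, ofReal_integral_eq_lintegral_ofReal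
      ((integrable_sqrt_mul hpm hqm hp hq hp0 hq0).const_mul 2)
      (ae_of_all _ fun x => by positivity),
    ← setLIntegral_eq_of_support_subset hsupp]
  simp_rw [← fun x => lintegral_min_mul_rpow_neg_two (hp0 x) (hq0 x)]
  rw [lintegral_lintegral_swap hmeas.aemeasurable]
  refine setLIntegral_congr_fun measurableSet_Ioi fun s hs => ?_
  have hs0 : 0 < s := hs
  have hnn : ∀ x, 0 ≤ q x * s ^ (-2 : ℝ) := fun x => mul_nonneg (hq0 x) (by positivity)
  have hsupp' : Function.support
      (fun x => ENNReal.ofReal (min (p x) (q x * s ^ (-2 : ℝ)))) ⊆ t := by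
    intro x hx
    by_contra hxt
    exact hx (by simp [htp x hxt])
  rw [setLIntegral_eq_of_support_subset hsupp']
  exact (ofReal_integral_eq_lintegral_ofReal (hp.inf (hq.mul_const _))
    (ae_of_all _ fun x => le_min (hp0 x) (hnn x))).symm

end Densities

/-- Extension of the Bradt–Karlin theorem: if the Bhattacharyya coefficient for the
signal set `β` (densities `pβ₁, pβ₂`) is strictly smaller than that of `β'`
(densities `pβ'₁, pβ'₂`) — equivalently, `B_α(ρ(β)) > B_α(ρ(β'))` — then there exist
prior probabilities `Γ = (π₁, π₂)` for which the Bayes error probability of `β` is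
strictly smaller than that of `β'`. -/
theorem bbd_ranking_implies_error_ranking
    {Ω : Type*} [MeasurableSpace Ω] (μ : Measure Ω)
    (pβ₁ pβ₂ pβ'₁ pβ'₂ : Ω → ℝ)
    (hm₁ : Measurable pβ₁) (hm₂ : Measurable pβ₂)
    (hm'₁ : Measurable pβ'₁) (hm'₂ : Measurable pβ'₂)
    (h0₁ : ∀ x, 0 ≤ pβ₁ x) (h0₂ : ∀ x, 0 ≤ pβ₂ x)
    (h0'₁ : ∀ x, 0 ≤ pβ'₁ x) (h0'₂ : ∀ x, 0 ≤ pβ'₂ x)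
    (h1₁ : ∫ x, pβ₁ x ∂μ = 1) (h1₂ : ∫ x, pβ₂ x ∂μ = 1)
    (h1'₁ : ∫ x, pβ'₁ x ∂μ = 1) (h1'₂ : ∫ x, pβ'₂ x ∂μ = 1)
    (hρ : ∫ x, Real.sqrt (pβ₁ x * pβ₂ x) ∂μ <
          ∫ x, Real.sqrt (pβ'₁ x * pβ'₂ x) ∂μ) :
    ∃ π₁ π₂ : ℝ, 0 ≤ π₁ ∧ 0 ≤ π₂ ∧ π₁ + π₂ = 1 ∧
      ∫ x, min (π₁ * pβ₁ x) (π₂ * pβ₂ x) ∂μ <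
      ∫ x, min (π₁ * pβ'₁ x) (π₂ * pβ'₂ x) ∂μ := by
  by_contra! hcon
  have hi₁ : Integrable pβ₁ μ := .of_integral_ne_zero (by simp [h1₁])
  have hi₂ : Integrable pβ₂ μ := .of_integral_ne_zero (by simp [h1₂])
  have hi'₁ : Integrable pβ'₁ μ := .of_integral_ne_zero (by simp [h1'₁])
  have hi'₂ : Integrable pβ'₂ μ := .of_integral_ne_zero (by simp [h1'₂])
  have hmin : ∀ r : ℝ, 0 ≤ r → ∫ x, min (pβ'₁ x) (pβ'₂ x * r) ∂μ ≤
      ∫ x, min (pβ₁ x) (pβ₂ x * r) ∂μ := by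
    intro r hr
    have hr1 : 0 < 1 + r := by positivity
    have hscale : ∀ u v : ℝ, min (1 / (1 + r) * u) (r / (1 + r) * v) =
        1 / (1 + r) * min u (v * r) := by
      intro u v
      rw [mul_min_of_nonneg _ _ (by positivity)]
      congr 1
      ring
    have h := hcon (1 / (1 + r)) (r / (1 + r)) (by positivity) (by positivity)
      (by field_simp)
    simp_rw [hscale, integral_const_mul] at h
    exact le_of_mul_le_mul_left h (by positivity)
  have hle : ENNReal.ofReal (2 * ∫ x, √(pβ'₁ x * pβ'₂ x) ∂μ) ≤
      ENNReal.ofReal (2 * ∫ x, √(pβ₁ x * pβ₂ x) ∂μ) := by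
    rw [ofReal_two_mul_integral_sqrt_mul_eq_lintegral hm₁ hm₂ hi₁ hi₂ h0₁ h0₂,
      ofReal_two_mul_integral_sqrt_mul_eq_lintegral hm'₁ hm'₂ hi'₁ hi'₂ h0'₁ h0'₂]
    refine setLIntegral_mono' measurableSet_Ioi fun s hs => ENNReal.ofReal_le_ofReal ?_
    exact hmin _ (Real.rpow_nonneg (le_of_lt hs) _)
  have h0 : 0 ≤ ∫ x, √(pβ₁ x * pβ₂ x) ∂μ := integral_nonneg fun x => Real.sqrt_nonneg _
  rw [ENNReal.ofReal_le_ofReal_iff (by positivity)] at hle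
  linarith
end

section
/- Let p and q be probability densities with respect to a measure λ, with Bhattacharyya coefficient ρ = ∫√(pq) dλ, and equal priors π₁ = π₂ = 1/2, so the Bayes error probability is P_e = ∫ min(p/2, q/2) dλ. Then (1/2)·(1 − √(1 − ρ²)) ≤ P_e ≤ ρ/2. -/
open MeasureTheory

theorem Real.two_mul_sqrt_mul_le {a b : ℝ} (ha : 0 ≤ a) (hb : 0 ≤ b) (s : ℝ) :
    2 * s * √(a * b) ≤ a + s ^ 2 * b := by
  rw [Real.sqrt_mul ha]
  nlinarith [sq_nonneg (√a - s * √b), Real.sq_sqrt ha, Real.sq_sqrt hb]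

theorem MeasureTheory.Integrable.sqrt_mul {Ω : Type*} [MeasurableSpace Ω] {μ : Measure Ω}
    {f g : Ω → ℝ} (hf : Integrable f μ) (hg : Integrable g μ)
    (hf0 : ∀ x, 0 ≤ f x) (hg0 : ∀ x, 0 ≤ g x) :
    Integrable (fun x => √(f x * g x)) μ := by
  refine (hf.add hg).mono'
    (Real.continuous_sqrt.comp_aestronglyMeasurable
      (hf.aestronglyMeasurable.mul hg.aestronglyMeasurable))
    (Filter.Eventually.of_forall fun x => ?_)
  rw [Real.norm_of_nonneg (Real.sqrt_nonneg _), Pi.add_apply]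
  linarith [Real.two_mul_sqrt_mul_le (hf0 x) (hg0 x) 1, Real.sqrt_nonneg (f x * g x)]

/-- The Cauchy-Schwarz inequality for the integral of a geometric mean. -/
theorem MeasureTheory.sq_integral_sqrt_mul_le {Ω : Type*} [MeasurableSpace Ω] {μ : Measure Ω}
    {f g : Ω → ℝ} (hf : Integrable f μ) (hg : Integrable g μ)
    (hf0 : ∀ x, 0 ≤ f x) (hg0 : ∀ x, 0 ≤ g x) :
    (∫ x, √(f x * g x) ∂μ) ^ 2 ≤ (∫ x, f x ∂μ) * ∫ x, g x ∂μ := by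
  have key (s : ℝ) :
      2 * s * ∫ x, √(f x * g x) ∂μ ≤ (∫ x, f x ∂μ) + s ^ 2 * ∫ x, g x ∂μ := by
    rw [← integral_const_mul, ← integral_const_mul, ← integral_add hf (hg.const_mul _)]
    exact integral_mono ((hf.sqrt_mul hg hf0 hg0).const_mul _) (hf.add (hg.const_mul _))
      fun x => Real.two_mul_sqrt_mul_le (hf0 x) (hg0 x) s
  have hd := discrim_le_zero (a := ∫ x, g x ∂μ) (b := -2 * ∫ x, √(f x * g x) ∂μ)
    (c := ∫ x, f x ∂μ) fun s => by linarith [key s]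
  rw [discrim] at hd
  linarith

theorem bayes_error_bounds_bhattacharyya
    {Ω : Type*} [MeasurableSpace Ω] (μ : Measure Ω) (p q : Ω → ℝ)
    (hpm : Measurable p) (hqm : Measurable q)
    (hp0 : ∀ x, 0 ≤ p x) (hq0 : ∀ x, 0 ≤ q x)
    (hp1 : ∫ x, p x ∂μ = 1) (hq1 : ∫ x, q x ∂μ = 1) :
    (1 / 2) * (1 - Real.sqrt (1 - (∫ x, Real.sqrt (p x * q x) ∂μ) ^ 2)) ≤
      ∫ x, min (p x / 2) (q x / 2) ∂μ ∧
    ∫ x, min (p x / 2) (q x / 2) ∂μ ≤ (∫ x, Real.sqrt (p x * q x) ∂μ) / 2 := by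
  have hp : Integrable p μ := .of_integral_ne_zero (by simp [hp1])
  have hq : Integrable q μ := .of_integral_ne_zero (by simp [hq1])
  have hmin : Integrable (fun x => min (p x) (q x)) μ := hp.inf hq
  have hmax : Integrable (fun x => max (p x) (q x)) μ := hp.sup hq
  have hsum : (∫ x, min (p x) (q x) ∂μ) + ∫ x, max (p x) (q x) ∂μ = 2 := by
    rw [← integral_add hmin hmax]
    simp only [min_add_max]
    rw [integral_add hp hq, hp1, hq1]
    norm_num
  have hcs := sq_integral_sqrt_mul_le hmin hmax (fun x => le_min (hp0 x) (hq0 x))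
    (fun x => le_max_of_le_left (hp0 x))
  simp only [min_mul_max] at hcs
  have hhalf : ∫ x, min (p x / 2) (q x / 2) ∂μ = (∫ x, min (p x) (q x) ∂μ) / 2 := by
    simp only [min_div_div_right (zero_le_two (α := ℝ)), integral_div]
  rw [hhalf]
  constructor
  · have : 1 - ∫ x, min (p x) (q x) ∂μ ≤ √(1 - (∫ x, √(p x * q x) ∂μ) ^ 2) := by
      apply Real.le_sqrt_of_sq_le
      rw [← eq_sub_iff_add_eq'] at hsum
      rw [hsum] at hcs
      linarith
    linarith
  · refine div_le_div_of_nonneg_right ?_ zero_le_two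
    refine integral_mono hmin (hp.sqrt_mul hq hp0 hq0) fun x => Real.le_sqrt_of_sq_le ?_
    rw [sq]
    exact mul_le_mul (min_le_left _ _) (min_le_right _ _) (le_min (hp0 x) (hq0 x)) (hp0 x)
end

section
/- Let {f(·|θ)} be a parametric family of positive probability densities satisfying the regularity conditions under which ρ(θ,θ)=1, ∂ρ(θ,φ)/∂φ|_{φ=θ}=0 and ∂²ρ(θ,φ)/∂φ²|_{φ=θ} = −I_f(θ)/4. Fix α with α < 0 or α > 1 and set Z_θ(φ) = B_α(ρ(θ,φ)) = log(1 − (1−ρ(θ,φ))/α)/log(1 − 1/α). Then Z_θ(θ) = 0, Z_θ'(θ) = 0, and Z_θ''(θ) = C(α)·I_f(θ) where C(α) = −1/(4α·log(1 − 1/α)) and C(α) > 0; hence B_α(θ,φ) ∼ C(α)·I_f(θ)·(φ−θ)²/2 as φ → θ, so the curvature of the BBD measure at φ = θ equals the Fisher information up to the positive multiplicative constant C(α). -/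
open MeasureTheory Asymptotics

/-- The Bhattacharyya coefficient between the members `θ` and `φ` of a parametric
family of densities `f`. -/
noncomputable def rhoCoef {Ω : Type*} [MeasurableSpace Ω] (μ : Measure Ω)
    (f : ℝ → Ω → ℝ) (θ φ : ℝ) : ℝ :=
  ∫ x, Real.sqrt (f θ x * f φ x) ∂μ

/-- The Fisher information of a parametric family of densities `f` at `θ`. -/
noncomputable def fisherInfo {Ω : Type*} [MeasurableSpace Ω] (μ : Measure Ω)
    (f : ℝ → Ω → ℝ) (θ : ℝ) : ℝ :=
  ∫ x, f θ x * (deriv (fun t => Real.log (f t x)) θ) ^ 2 ∂μ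

/-- The constant `C(α) = -1/(4 α log(1 - 1/α))`. -/
noncomputable def Cconst (α : ℝ) : ℝ := -1 / (4 * α * Real.log (1 - 1 / α))

/-- Second-order Taylor expansion with Peano remainder at a point where `g` is `C²`. -/
theorem ContDiffAt.isLittleO_sub_taylor_two {g : ℝ → ℝ} {a : ℝ} (hg : ContDiffAt ℝ 2 g a) :
    (fun x => g x - (g a + deriv g a * (x - a) + iteratedDeriv 2 g a * (x - a) ^ 2 / 2))
      =o[nhds a] (fun x => (x - a) ^ 2) := by
  obtain ⟨u, hu, hgu⟩ := hg.contDiffOn le_rfl (by simp)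
  obtain ⟨ε, hε, hball⟩ := Metric.mem_nhds_iff.1 hu
  have ha : a ∈ Metric.ball a ε := Metric.mem_ball_self hε
  have h := taylor_isLittleO (n := 2) (convex_ball a ε) ha (hgu.mono hball)
  rw [Metric.isOpen_ball.nhdsWithin_eq ha] at h
  refine h.congr_left fun x => ?_
  simp only [taylor_within_apply, Finset.sum_range_succ, Finset.sum_range_zero,
    iteratedDerivWithin_of_isOpen Metric.isOpen_ball ha, iteratedDeriv_zero, iteratedDeriv_one,
    smul_eq_mul]
  norm_num [Nat.factorial]
  ring

theorem ContDiffAt.differentiableAt_deriv {g : ℝ → ℝ} {a : ℝ} (hg : ContDiffAt ℝ 2 g a) :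
    DifferentiableAt ℝ (deriv g) a := by
  have h : ContDiffAt ℝ 1 (fderiv ℝ g) a := hg.fderiv_right (by norm_num)
  exact (h.differentiableAt (by simp)).clm_apply (differentiableAt_const (1 : ℝ))

theorem HasDerivAt.bbd {r : ℝ → ℝ} {r' α x : ℝ} (hr : HasDerivAt r r' x)
    (hx : 1 - (1 - r x) / α ≠ 0) :
    HasDerivAt (fun y => BBD α (r y))
      (r' / α / (1 - (1 - r x) / α) / Real.log (1 - 1 / α)) x := by
  have h : HasDerivAt (fun y => 1 - (1 - r y) / α) (r' / α) x := by
    simpa [neg_div] using ((hr.const_sub 1).div_const α).const_sub 1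
  exact (h.log hx).div_const _

theorem ContDiffAt.bbd {r : ℝ → ℝ} {α x : ℝ} {n : WithTop ℕ∞} (hr : ContDiffAt ℝ n r x)
    (hx : 1 - (1 - r x) / α ≠ 0) : ContDiffAt ℝ n (fun y => BBD α (r y)) x :=
  ((contDiffAt_const.sub ((contDiffAt_const.sub hr).div_const α)).log hx).div_const _

/-- At a critical point where `r = 1`, the second derivative of `BBD α ∘ r` is a multiple of
that of `r`. -/
theorem iteratedDeriv_two_bbd {r : ℝ → ℝ} {α a : ℝ} (hr : ContDiffAt ℝ 2 r a)
    (ha : r a = 1) (hr' : deriv r a = 0) :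
    iteratedDeriv 2 (fun y => BBD α (r y)) a =
      iteratedDeriv 2 r a / α / Real.log (1 - 1 / α) := by
  have hcont : ContinuousAt (fun y => 1 - (1 - r y) / α) a :=
    continuousAt_const.sub ((continuousAt_const.sub hr.continuousAt).div_const α)
  have hne : ∀ᶠ y in nhds a, 1 - (1 - r y) / α ≠ 0 :=
    hcont.eventually_ne (by simp [ha])
  have hderiv : deriv (fun y => BBD α (r y)) =ᶠ[nhds a]
      fun y => deriv r y / α / (1 - (1 - r y) / α) / Real.log (1 - 1 / α) := by
    filter_upwards [hne, hr.eventually (by simp)] with y hy hry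
    exact ((hry.differentiableAt (by simp)).hasDerivAt.bbd hy).deriv
  have hu : HasDerivAt (fun y => 1 - (1 - r y) / α) (deriv r a / α) a := by
    simpa [neg_div] using
      (((hr.differentiableAt (by simp)).hasDerivAt.const_sub 1).div_const α).const_sub 1
  have h2 := ((hr.differentiableAt_deriv.hasDerivAt.div_const α).div hu
    (by simp [ha])).div_const (Real.log (1 - 1 / α))
  rw [iteratedDeriv_succ, iteratedDeriv_one, hderiv.deriv_eq, iteratedDeriv_succ,
    iteratedDeriv_one]
  refine h2.deriv.trans ?_
  simp [ha, hr']

theorem Cconst_pos {α : ℝ} (hα : α < 0 ∨ 1 < α) : 0 < Cconst α := by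
  have h : α * Real.log (1 - 1 / α) < 0 := by
    rcases hα with h | h
    · refine mul_neg_of_neg_of_pos h (Real.log_pos ?_)
      linarith [one_div_neg.2 h]
    · have h0 : 0 < α := by linarith
      refine mul_neg_of_pos_of_neg h0 (Real.log_neg ?_ ?_)
      · linarith [(div_lt_one h0).2 h]
      · linarith [one_div_pos.2 h0]
  exact div_pos_of_neg_of_neg (by norm_num) (by linarith)

/-- Curvature of the BBD measure and Fisher information: for a parametric family of
positive densities satisfying the regularity conditions under which `ρ(θ,θ) = 1`,
`∂ρ/∂φ|_{φ=θ} = 0` and `∂²ρ/∂φ²|_{φ=θ} = -I_f(θ)/4`, the function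
`Z_θ(φ) = B_α(ρ(θ,φ))` satisfies `Z_θ(θ) = 0`, `Z_θ'(θ) = 0`,
`Z_θ''(θ) = C(α)·I_f(θ)` with `C(α) > 0`, and
`B_α(θ,φ) ∼ C(α)·I_f(θ)·(φ-θ)²/2` as `φ → θ`. -/
theorem bbd_curvature_eq_fisher_info
    {Ω : Type*} [MeasurableSpace Ω] (μ : Measure Ω) (f : ℝ → Ω → ℝ) (θ : ℝ)
    (hfpos : ∀ t x, 0 < f t x)
    (hf1 : ∀ t, ∫ x, f t x ∂μ = 1)
    (α : ℝ) (hα : α < 0 ∨ 1 < α)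
    (hρsmooth : ContDiffAt ℝ 2 (fun φ => rhoCoef μ f θ φ) θ)
    (hρθθ : rhoCoef μ f θ θ = 1)
    (hρ' : deriv (fun φ => rhoCoef μ f θ φ) θ = 0)
    (hρ'' : iteratedDeriv 2 (fun φ => rhoCoef μ f θ φ) θ = -fisherInfo μ f θ / 4) :
    BBD α (rhoCoef μ f θ θ) = 0 ∧
    deriv (fun φ => BBD α (rhoCoef μ f θ φ)) θ = 0 ∧
    iteratedDeriv 2 (fun φ => BBD α (rhoCoef μ f θ φ)) θ =
      Cconst α * fisherInfo μ f θ ∧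
    0 < Cconst α ∧
    (fun φ => BBD α (rhoCoef μ f θ φ) -
        Cconst α * fisherInfo μ f θ * (φ - θ) ^ 2 / 2) =o[nhds θ]
      (fun φ => (φ - θ) ^ 2) := by
  have hne : 1 - (1 - rhoCoef μ f θ θ) / α ≠ 0 := by simp [hρθθ]
  have h0 : BBD α (rhoCoef μ f θ θ) = 0 := by simp [BBD, hρθθ]
  have h1 : deriv (fun φ => BBD α (rhoCoef μ f θ φ)) θ = 0 := by
    rw [((hρsmooth.differentiableAt (by simp)).hasDerivAt.bbd hne).deriv, hρ']
    simp
  have h2 : iteratedDeriv 2 (fun φ => BBD α (rhoCoef μ f θ φ)) θ =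
      Cconst α * fisherInfo μ f θ := by
    rw [iteratedDeriv_two_bbd hρsmooth hρθθ hρ', hρ'', Cconst]
    simp only [div_eq_mul_inv, mul_inv]
    ring
  refine ⟨h0, h1, h2, Cconst_pos hα, ?_⟩
  simpa only [h0, h1, h2, zero_mul, zero_add] using
    (hρsmooth.bbd hne).isLittleO_sub_taylor_two
end

section
/- The function g(ρ) = (1 − ρ)/(−log₂((1+ρ)/2)) is non-decreasing on [0,1) (its derivative is nonnegative there), g(0) = 1, and sup_{ρ∈[0,1)} g(ρ) = lim_{ρ→1⁻} g(ρ) = log 4 (natural logarithm). -/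
open Filter

/-- The ratio `g(ρ) = H²(ρ)/ζ(ρ) = (1-ρ)/(-log₂((1+ρ)/2))`. -/
noncomputable def gRatio (ρ : ℝ) : ℝ :=
  (1 - ρ) / (-(Real.log ((1 + ρ) / 2) / Real.log 2))

lemma log_half_one_add_neg {ρ : ℝ} (hρ : ρ ∈ Set.Ico (0 : ℝ) 1) :
    Real.log ((1 + ρ) / 2) < 0 := by
  obtain ⟨h0, h1⟩ := hρ
  exact Real.log_neg (by linarith) (by linarith)

lemma hasDerivAt_log_half_one_add {ρ : ℝ} (hρ : 1 + ρ ≠ 0) :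
    HasDerivAt (fun x : ℝ ↦ Real.log ((1 + x) / 2)) (1 / (1 + ρ)) ρ := by
  convert (((hasDerivAt_id ρ).const_add 1).div_const 2).log (by simpa using hρ) using 1
  simp only [id]
  field_simp
  exact (div_self hρ).symm

lemma hasDerivAt_gRatio {ρ : ℝ} (hρ : ρ ∈ Set.Ico (0 : ℝ) 1) :
    HasDerivAt gRatio ((Real.log ((1 + ρ) / 2) + (1 - ρ) / (1 + ρ)) / Real.log 2 /
      (-(Real.log ((1 + ρ) / 2) / Real.log 2)) ^ 2) ρ := by
  have hlog := log_half_one_add_neg hρ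
  have h2 : 0 < Real.log 2 := Real.log_pos one_lt_two
  have hden : -(Real.log ((1 + ρ) / 2) / Real.log 2) ≠ 0 :=
    neg_ne_zero.2 (div_ne_zero hlog.ne h2.ne')
  have hpos : 1 + ρ ≠ 0 := by linarith [hρ.1]
  refine (((hasDerivAt_id' ρ).const_sub 1).fun_div
    ((hasDerivAt_log_half_one_add hpos).div_const (Real.log 2)).fun_neg hden).congr_deriv ?_
  congr 1
  ring

lemma deriv_gRatio_nonneg {ρ : ℝ} (hρ : ρ ∈ Set.Ico (0 : ℝ) 1) : 0 ≤ deriv gRatio ρ := by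
  rw [(hasDerivAt_gRatio hρ).deriv]
  have hpos : 0 < 1 + ρ := by linarith [hρ.1]
  have hlog := Real.one_sub_inv_le_log_of_pos (half_pos hpos)
  have hinv : 1 - ((1 + ρ) / 2)⁻¹ = -((1 - ρ) / (1 + ρ)) := by
    field_simp
    ring
  have hnum : 0 ≤ Real.log ((1 + ρ) / 2) + (1 - ρ) / (1 + ρ) := by linarith
  have h2 : 0 < Real.log 2 := Real.log_pos one_lt_two
  positivity

lemma gRatio_monotoneOn : MonotoneOn gRatio (Set.Ico (0 : ℝ) 1) :=
  monotoneOn_of_deriv_nonneg (convex_Ico 0 1)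
    (fun _ hρ ↦ (hasDerivAt_gRatio hρ).continuousAt.continuousWithinAt)
    (fun _ hρ ↦ (hasDerivAt_gRatio (interior_subset hρ)).differentiableAt.differentiableWithinAt)
    (fun _ hρ ↦ deriv_gRatio_nonneg (interior_subset hρ))

lemma gRatio_zero : gRatio 0 = 1 := by
  have h2 : Real.log 2 ≠ 0 := (Real.log_pos one_lt_two).ne'
  simp [gRatio, h2]

lemma tendsto_gRatio_one :
    Tendsto gRatio (nhdsWithin 1 (Set.Iio 1)) (nhds (Real.log 4)) := by
  have hslope := ((hasDerivAt_log_half_one_add (ρ := 1) (by norm_num)).tendsto_slope.mono_left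
    (nhdsWithin_mono 1 fun x (hx : x ∈ Set.Iio 1) ↦ ne_of_lt hx)).inv₀ (by norm_num)
  have h4 : Real.log 4 = Real.log 2 * (1 / (1 + 1 : ℝ))⁻¹ := by
    rw [show (4 : ℝ) = 2 ^ 2 by norm_num, Real.log_pow]
    norm_num
    ring
  rw [h4]
  refine (hslope.const_mul (Real.log 2)).congr fun x ↦ ?_
  have hone : Real.log ((1 + 1) / 2) = 0 := by norm_num
  rw [slope_def_field, hone, sub_zero, inv_div, gRatio, ← neg_sub x 1, neg_div_neg_eq,
    div_div_eq_mul_div]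
  ring

lemma sSup_gRatio_image : sSup (gRatio '' Set.Ico (0 : ℝ) 1) = Real.log 4 := by
  refine IsLUB.csSup_eq ⟨?_, fun b hb ↦ ?_⟩ ⟨_, Set.mem_image_of_mem _ ⟨le_rfl, one_pos⟩⟩
  · rintro _ ⟨ρ, hρ, rfl⟩
    refine ge_of_tendsto tendsto_gRatio_one ?_
    filter_upwards [Ioo_mem_nhdsLT hρ.2] with x hx
    exact gRatio_monotoneOn hρ ⟨hρ.1.trans hx.1.le, hx.2⟩ hx.1.le
  · refine le_of_tendsto tendsto_gRatio_one ?_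
    filter_upwards [Ico_mem_nhdsLT (one_pos (α := ℝ))] with x hx
    exact hb (Set.mem_image_of_mem _ hx)

theorem gRatio_monotone_sup :
    MonotoneOn gRatio (Set.Ico (0 : ℝ) 1) ∧
    (∀ ρ ∈ Set.Ico (0 : ℝ) 1, 0 ≤ deriv gRatio ρ) ∧
    gRatio 0 = 1 ∧
    sSup (gRatio '' Set.Ico (0 : ℝ) 1) = Real.log 4 ∧
    Tendsto gRatio (nhdsWithin 1 (Set.Iio 1)) (nhds (Real.log 4)) :=
  ⟨gRatio_monotoneOn, fun _ hρ ↦ deriv_gRatio_nonneg hρ, gRatio_zero, sSup_gRatio_image,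
    tendsto_gRatio_one⟩
end

section
/- For every ρ ∈ [0,1], ζ(ρ) ≤ H²(ρ) ≤ (log 4)·ζ(ρ), where ζ(ρ) = −log₂((1+ρ)/2) and H²(ρ) = 1 − ρ; moreover the constants 1 and log 4 are sharp: inf_{ρ∈[0,1)} H²(ρ)/ζ(ρ) = 1 and sup_{ρ∈[0,1)} H²(ρ)/ζ(ρ) = log 4. -/
/-- `ζ(ρ) = -log₂((1+ρ)/2)`, the `α = 2` case of the BBD measure. -/
noncomputable def zetaBBD (ρ : ℝ) : ℝ := -(Real.log ((1 + ρ) / 2) / Real.log 2)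

theorem log_four_eq_two_mul_log_two : Real.log 4 = 2 * Real.log 2 := by
  rw [show (4 : ℝ) = 2 ^ 2 by norm_num, Real.log_pow]
  norm_num

theorem zetaBBD_zero : zetaBBD 0 = 1 := by
  have h2 : Real.log 2 ≠ 0 := (Real.log_pos one_lt_two).ne'
  simp [zetaBBD, h2]

theorem zetaBBD_mul_log_two (ρ : ℝ) : zetaBBD ρ * Real.log 2 = -Real.log ((1 + ρ) / 2) := by
  have h2 : Real.log 2 ≠ 0 := (Real.log_pos one_lt_two).ne'
  rw [zetaBBD, neg_mul, div_mul_cancel₀ _ h2]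

theorem zetaBBD_le {ρ : ℝ} (h0 : 0 ≤ ρ) (h1 : ρ ≤ 1) : zetaBBD ρ ≤ 1 - ρ := by
  have h2 : 0 < Real.log 2 := Real.log_pos one_lt_two
  have hc := strictConcaveOn_log_Ioi.concaveOn.2 (Set.mem_Ioi.2 one_pos)
    (Set.mem_Ioi.2 (show (0 : ℝ) < 1 / 2 by norm_num)) h0 (sub_nonneg.2 h1) (by ring)
  simp only [smul_eq_mul, Real.log_one, one_div, Real.log_inv] at hc
  rw [show ρ * 1 + (1 - ρ) * 2⁻¹ = (1 + ρ) / 2 by ring] at hc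
  refine le_of_mul_le_mul_right ?_ h2
  rw [zetaBBD_mul_log_two]
  linarith

theorem le_log_four_mul_zetaBBD {ρ : ℝ} (h0 : 0 ≤ ρ) : 1 - ρ ≤ Real.log 4 * zetaBBD ρ := by
  have hz := zetaBBD_mul_log_two ρ
  have hlog := Real.log_le_sub_one_of_pos (show 0 < (1 + ρ) / 2 by linarith)
  rw [log_four_eq_two_mul_log_two]
  linarith

theorem zetaBBD_pos {ρ : ℝ} (h0 : 0 ≤ ρ) (h1 : ρ < 1) : 0 < zetaBBD ρ :=
  pos_of_mul_pos_right ((sub_pos.2 h1).trans_le (le_log_four_mul_zetaBBD h0))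
    (Real.log_nonneg (by norm_num))

theorem log_two_mul_one_add_le_div_zetaBBD {ρ : ℝ} (h0 : 0 ≤ ρ) (h1 : ρ < 1) :
    Real.log 2 * (1 + ρ) ≤ (1 - ρ) / zetaBBD ρ := by
  rw [le_div_iff₀ (zetaBBD_pos h0 h1)]
  have hlog := Real.one_sub_inv_le_log_of_pos (show 0 < (1 + ρ) / 2 by linarith)
  calc Real.log 2 * (1 + ρ) * zetaBBD ρ = (1 + ρ) * (zetaBBD ρ * Real.log 2) := by ring
    _ ≤ (1 + ρ) * (((1 + ρ) / 2)⁻¹ - 1) := by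
      rw [zetaBBD_mul_log_two]
      gcongr
      linarith
    _ = 1 - ρ := by
      have : 1 + ρ ≠ 0 := by positivity
      field_simp
      ring

theorem isLeast_div_zetaBBD :
    IsLeast ((fun ρ => (1 - ρ) / zetaBBD ρ) '' Set.Ico (0 : ℝ) 1) 1 := by
  refine ⟨⟨0, by simp, by simp [zetaBBD_zero]⟩, ?_⟩
  rintro _ ⟨ρ, ⟨h0, h1⟩, rfl⟩
  exact (one_le_div (zetaBBD_pos h0 h1)).2 (zetaBBD_le h0 h1.le)

theorem isLUB_div_zetaBBD :
    IsLUB ((fun ρ => (1 - ρ) / zetaBBD ρ) '' Set.Ico (0 : ℝ) 1) (Real.log 4) := by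
  have h2 : 0 < Real.log 2 := Real.log_pos one_lt_two
  refine ⟨?_, fun b hb => le_of_forall_lt fun w hw => ?_⟩
  · rintro _ ⟨ρ, ⟨h0, h1⟩, rfl⟩
    exact (div_le_iff₀ (zetaBBD_pos h0 h1)).2 (le_log_four_mul_zetaBBD h0)
  · rw [log_four_eq_two_mul_log_two, ← div_lt_iff₀ h2] at hw
    obtain ⟨ρ, hρ, h1⟩ := exists_between (max_lt one_pos (show w / Real.log 2 - 1 < 1 by linarith))
    obtain ⟨h0, hwρ⟩ := max_lt_iff.1 hρ
    refine lt_of_lt_of_le ?_ (hb ⟨ρ, ⟨h0.le, h1⟩, rfl⟩)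
    refine lt_of_lt_of_le ?_ (log_two_mul_one_add_le_div_zetaBBD h0.le h1)
    rw [mul_comm, ← div_lt_iff₀ h2]
    linarith

theorem zeta_hellinger_inequality_sharp :
    (∀ ρ ∈ Set.Icc (0 : ℝ) 1,
      zetaBBD ρ ≤ 1 - ρ ∧ 1 - ρ ≤ Real.log 4 * zetaBBD ρ) ∧
    sInf ((fun ρ => (1 - ρ) / zetaBBD ρ) '' Set.Ico (0 : ℝ) 1) = 1 ∧
    sSup ((fun ρ => (1 - ρ) / zetaBBD ρ) '' Set.Ico (0 : ℝ) 1) = Real.log 4 :=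
  ⟨fun _ h => ⟨zetaBBD_le h.1 h.2, le_log_four_mul_zetaBBD h.1⟩,
    isLeast_div_zetaBBD.csInf_eq,
    isLUB_div_zetaBBD.csSup_eq (isLeast_div_zetaBBD.nonempty)⟩
end

section
/- For every α > 1 and every ρ ∈ [0,1], B_α(ρ) ≤ 1 − ρ ≤ (−α·log(1 − 1/α))·B_α(ρ), where B_α(ρ) = log(1 − (1−ρ)/α)/log(1 − 1/α); i.e., the squared Hellinger distance H² = 1 − ρ is sandwiched between B_α and −α·log(1 − 1/α) times B_α. -/
theorem bbd_hellinger_sandwich (α : ℝ) (hα : 1 < α) (ρ : ℝ)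
    (hρ : ρ ∈ Set.Icc (0 : ℝ) 1) :
    BBD α ρ ≤ 1 - ρ ∧ 1 - ρ ≤ (-α * Real.log (1 - 1 / α)) * BBD α ρ := by
  obtain ⟨h0, h1⟩ := hρ
  have hα0 : 0 < α := by linarith
  have hinv : 1 / α < 1 := (div_lt_one hα0).2 hα
  have hinv0 : 0 < 1 / α := by positivity
  have hL : Real.log (1 - 1 / α) < 0 := Real.log_neg (by linarith) (by linarith)
  have hlt : (1 - ρ) / α < 1 := (div_lt_one hα0).2 (by linarith)
  unfold BBD
  constructor
  · rw [div_le_iff_of_neg hL]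
    have hconc := strictConcaveOn_log_Ioi.concaveOn.2
      (show 1 - 1 / α ∈ Set.Ioi (0 : ℝ) from sub_pos.2 hinv)
      (show (1 : ℝ) ∈ Set.Ioi (0 : ℝ) from Set.mem_Ioi.2 one_pos)
      (sub_nonneg.2 h1) h0 (by ring)
    simp only [smul_eq_mul, Real.log_one, mul_zero, add_zero] at hconc
    rwa [show (1 - ρ) * (1 - 1 / α) + ρ * 1 = 1 - (1 - ρ) / α by ring] at hconc
  · rw [mul_assoc, mul_div_cancel₀ _ hL.ne]
    have hlog := Real.log_le_sub_one_of_pos (sub_pos.2 hlt)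
    calc 1 - ρ = α * ((1 - ρ) / α) := by field_simp
      _ ≤ α * -Real.log (1 - (1 - ρ) / α) :=
        mul_le_mul_of_nonneg_left (by linarith) hα0.le
      _ = -α * Real.log (1 - (1 - ρ) / α) := by ring
end
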